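/- arXiv:math/0305370 — 2 statements merged into one kernel-verified Lean document; each statement's English description precedes it below -/
import Mathlib

section
/- Let (Λ,d) be a finitely aligned k-graph and let {t_λ : λ ∈ Λ} be a family of partial isometries in a C*-algebra satisfying relations (CK1)–(CK3). Then for every vertex v, every n ∈ ℕ^k and every finite subset E ⊆ vΛ^{≤n}, one has Σ_{λ ∈ E} t_λ t_λ* ≤ t_v. -/
open scoped BigOperators

/-- A `k`-graph: a countable small category (in arrows-only presentation, with objects
identified with the identity morphisms) together with a degree functor into `ℕ^k`
satisfying the factorisation property.  `comp l m` is the composite path `lm`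
(first `m`, then `l` in categorical order; range `rng l`, source `src m`), and is
only meaningful when `src l = rng m`. -/
structure KGraph (k : ℕ) where
  Path : Type
  countable : Countable Path
  src : Path → Path
  rng : Path → Path
  comp : Path → Path → Path
  deg : Path → Fin k → ℕ
  deg_src : ∀ l, deg (src l) = 0
  deg_rng : ∀ l, deg (rng l) = 0
  src_eq_of_deg_zero : ∀ v, deg v = 0 → src v = v
  rng_eq_of_deg_zero : ∀ v, deg v = 0 → rng v = v
  comp_src_self : ∀ l, comp l (src l) = l
  rng_comp_self : ∀ l, comp (rng l) l = l
  src_comp : ∀ l m, src l = rng m → src (comp l m) = src m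
  rng_comp : ∀ l m, src l = rng m → rng (comp l m) = rng l
  deg_comp : ∀ l m, src l = rng m → deg (comp l m) = deg l + deg m
  comp_assoc : ∀ l m n, src l = rng m → src m = rng n →
    comp (comp l m) n = comp l (comp m n)
  factorisation : ∀ (l : Path) (m n : Fin k → ℕ), deg l = m + n →
    ∃! p : Path × Path, deg p.1 = m ∧ deg p.2 = n ∧ src p.1 = rng p.2 ∧
      comp p.1 p.2 = l

namespace KGraph

variable {k : ℕ} (Λ : KGraph k)

/-- The vertices of a `k`-graph are the paths of degree `0`. -/
def IsVertex (v : Λ.Path) : Prop := Λ.deg v = 0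

/-- An edge is a path of degree `e_i` for some `i`. -/
def IsEdge (e : Λ.Path) : Prop := ∃ i : Fin k, Λ.deg e = Pi.single i 1

/-- `vΛ`, the set of paths with range `v`. -/
def withRange (v : Λ.Path) : Set Λ.Path := {l | Λ.rng l = v}

/-- `Λ^min(l,m)`, the set of pairs giving minimal common extensions of `l` and `m`. -/
def minExt (l m : Λ.Path) : Set (Λ.Path × Λ.Path) :=
  {p | Λ.src l = Λ.rng p.1 ∧ Λ.src m = Λ.rng p.2 ∧
    Λ.comp l p.1 = Λ.comp m p.2 ∧ Λ.deg (Λ.comp l p.1) = Λ.deg l ⊔ Λ.deg m}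

/-- A `k`-graph is finitely aligned if all the sets `Λ^min(l,m)` are finite. -/
def FinitelyAligned : Prop := ∀ l m, (Λ.minExt l m).Finite

/-- A subset `E ⊆ vΛ` is exhaustive if every path in `vΛ` has a common extension
with some member of `E`. -/
def Exhaustive (v : Λ.Path) (E : Set Λ.Path) : Prop :=
  ∀ m ∈ Λ.withRange v, ∃ l ∈ E, (Λ.minExt l m).Nonempty

/-- `Λ^{≤ n}`. -/
def degLe (n : Fin k → ℕ) : Set Λ.Path :=
  {l | Λ.deg l ≤ n ∧ ∀ i : Fin k, Λ.deg l i < n i →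
    ¬∃ e, Λ.rng e = Λ.src l ∧ Λ.deg e = Pi.single i 1}

end KGraph

open Classical in
/-- The sum of `f` over a set `S`, defined to be `0` if `S` is infinite. -/
noncomputable def setSum {ι A : Type*} [AddCommMonoid A] (S : Set ι) (f : ι → A) : A :=
  if h : S.Finite then ∑ i ∈ h.toFinset, f i else 0

open Classical in
/-- The product of `f` over a set `S` taken in an arbitrary (but fixed) order,
defined to be `1` if `S` is infinite.  All products appearing below have commuting
factors, for which this is the usual product over a finite set. -/
noncomputable def setProd {ι A : Type*} [Monoid A] (S : Set ι) (f : ι → A) : A :=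
  if h : S.Finite then (h.toFinset.toList.map f).prod else 1

namespace KGraph

variable {k : ℕ} (Λ : KGraph k) {A : Type*} [Ring A] [StarRing A]

/-- Relations (CK1)–(CK3) for a family of partial isometries indexed by a `k`-graph. -/
structure IsCK13 (t : Λ.Path → A) : Prop where
  partialIsometry : ∀ l, t l * star (t l) * t l = t l
  vertex_projection : ∀ v, Λ.IsVertex v → star (t v) = t v ∧ t v * t v = t v
  vertex_orthogonal : ∀ v w, Λ.IsVertex v → Λ.IsVertex w → v ≠ w → t v * t w = 0
  comp_mul : ∀ l m, Λ.src l = Λ.rng m → t l * t m = t (Λ.comp l m)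
  ck3 : ∀ l m, star (t l) * t m =
    setSum (Λ.minExt l m) fun p => t p.1 * star (t p.2)

/-- A Cuntz–Krieger `Λ`-family: relations (CK1)–(CK4). -/
structure IsCKFamily (t : Λ.Path → A) extends IsCK13 Λ t : Prop where
  ck4 : ∀ v E, Λ.IsVertex v → E ⊆ Λ.withRange v → E.Finite → Λ.Exhaustive v E →
    setProd E (fun l => t v - t l * star (t l)) = 0

/-- Condition (†) on a subset `F ⊆ Λ`. -/
def DaggerClosed (F : Set Λ.Path) : Prop :=
  ∀ l m σ τ a b, l ∈ F → m ∈ F → σ ∈ F → τ ∈ F →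
    Λ.deg l = Λ.deg m → Λ.deg σ = Λ.deg τ →
    Λ.src l = Λ.src m → Λ.src σ = Λ.src τ →
    (a, b) ∈ Λ.minExt m σ → Λ.comp l a ∈ F ∧ Λ.comp τ b ∈ F

/-- `ΠE`, the smallest subset of `Λ` containing `E` and satisfying (†). -/
def piSet (E : Set Λ.Path) : Set Λ.Path := ⋂₀ {F | E ⊆ F ∧ Λ.DaggerClosed F}

/-- For `P ⊆ Λ` and a path `l`, the set `{ν ∈ s(l)Λ : d(ν) > 0 and lν ∈ P}`;
with `P = ΠE` this is the set `T(l)`. -/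
def extInto (P : Set Λ.Path) (l : Λ.Path) : Set Λ.Path :=
  {ν | Λ.src l = Λ.rng ν ∧ Λ.deg ν ≠ 0 ∧ Λ.comp l ν ∈ P}

/-- The projection `Q(t)^{ΠE}_l`. -/
noncomputable def Qproj (t : Λ.Path → A) (E : Set Λ.Path) (l : Λ.Path) : A :=
  t l * star (t l) *
    setProd (Λ.extInto (Λ.piSet E) l)
      (fun ν => t l * star (t l) - t (Λ.comp l ν) * star (t (Λ.comp l ν)))

/-- The matrix unit `Θ(t,E;l,m) = Q(t)^{ΠE}_l t_l t_m^*`. -/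
noncomputable def Theta (t : Λ.Path → A) (E : Set Λ.Path) (l m : Λ.Path) : A :=
  Λ.Qproj t E l * (t l * star (t m))

end KGraph

/-- A degree-preserving functor `x : Ω_{k,m} → Λ` for some `m ∈ (ℕ ∪ {∞})^k`,
recorded by its degree `m` and its values `map p q` on the morphisms `(p,q)` of
`Ω_{k,m}` (normalised to the junk value `map 0 0` on pairs `(p,q)` that are not
morphisms of `Ω_{k,m}`). -/
structure OmegaMor {k : ℕ} (Λ : KGraph k) where
  m : Fin k → ℕ∞
  map : (Fin k → ℕ) → (Fin k → ℕ) → Λ.Path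
  deg_map : ∀ p q : Fin k → ℕ, p ≤ q → (∀ i, (q i : ℕ∞) ≤ m i) →
    Λ.deg (map p q) = q - p
  rng_map : ∀ p q : Fin k → ℕ, p ≤ q → (∀ i, (q i : ℕ∞) ≤ m i) →
    Λ.rng (map p q) = map p p
  src_map : ∀ p q : Fin k → ℕ, p ≤ q → (∀ i, (q i : ℕ∞) ≤ m i) →
    Λ.src (map p q) = map q q
  comp_map : ∀ p q r : Fin k → ℕ, p ≤ q → q ≤ r → (∀ i, (r i : ℕ∞) ≤ m i) →
    Λ.comp (map p q) (map q r) = map p r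
  map_default : ∀ p q : Fin k → ℕ, ¬(p ≤ q ∧ ∀ i, (q i : ℕ∞) ≤ m i) →
    map p q = map 0 0

/-- `x` is a boundary path: there is `n_x ≤ m` such that whenever `n_x ≤ n ≤ m`
and `n_i = m_i`, the vertex `x(n)` receives no edge of degree `e_i`. -/
def OmegaMor.IsBoundary {k : ℕ} {Λ : KGraph k} (x : OmegaMor Λ) : Prop :=
  ∃ nx : Fin k → ℕ, (∀ i, (nx i : ℕ∞) ≤ x.m i) ∧
    ∀ n : Fin k → ℕ, nx ≤ n → (∀ i, (n i : ℕ∞) ≤ x.m i) →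
      ∀ i : Fin k, (n i : ℕ∞) = x.m i →
        ¬∃ e, Λ.rng e = x.map n n ∧ Λ.deg e = Pi.single i 1


namespace KGraph

variable {k : ℕ} (Λ : KGraph k)

/-- A path whose degree is nonzero in coordinate `i` starts with an edge of degree `e_i`. -/
theorem exists_edge_of_deg_ne_zero (a : Λ.Path) (i : Fin k) (ha : Λ.deg a i ≠ 0) :
    ∃ e, Λ.rng e = Λ.rng a ∧ Λ.deg e = Pi.single i 1 := by
  have hdeg : Λ.deg a = Pi.single i 1 + (Λ.deg a - Pi.single i 1) := by
    funext j
    by_cases hj : j = i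
    · subst hj
      simp only [Pi.add_apply, Pi.sub_apply, Pi.single_eq_same]
      omega
    · simp [Pi.single_eq_of_ne hj]
  obtain ⟨⟨p, q⟩, ⟨hp, -, hpq, hcomp⟩, -⟩ := Λ.factorisation a _ _ hdeg
  exact ⟨p, by rw [← hcomp, Λ.rng_comp p q hpq], hp⟩

/-- A path in `Λ^{≤ n}` has no proper extension of degree at most `n`. -/
theorem comp_eq_self_of_mem_degLe {n : Fin k → ℕ} {l a : Λ.Path} (hl : l ∈ Λ.degLe n)
    (hla : Λ.src l = Λ.rng a) (hn : Λ.deg (Λ.comp l a) ≤ n) : Λ.comp l a = l := by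
  have ha : Λ.deg a = 0 := by
    funext i
    by_contra hi
    have hle : Λ.deg (Λ.comp l a) i ≤ n i := hn i
    rw [Λ.deg_comp l a hla, Pi.add_apply] at hle
    have hpos : Λ.deg a i ≠ 0 := hi
    refine hl.2 i (by clear hi; omega) ?_
    rw [hla]
    exact Λ.exists_edge_of_deg_ne_zero a i hpos
  rw [← Λ.rng_eq_of_deg_zero a ha, ← hla, Λ.comp_src_self]

/-- Distinct paths in `Λ^{≤ n}` have no common extensions of minimal degree. -/
theorem minExt_eq_empty_of_mem_degLe {n : Fin k → ℕ} {l m : Λ.Path} (hl : l ∈ Λ.degLe n)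
    (hm : m ∈ Λ.degLe n) (hlm : l ≠ m) : Λ.minExt l m = ∅ := by
  refine Set.eq_empty_of_forall_notMem ?_
  rintro ⟨a, b⟩ ⟨hla, hmb, hcomp, hdeg⟩
  have hn : Λ.deg (Λ.comp l a) ≤ n := hdeg.trans_le (sup_le hl.1 hm.1)
  refine hlm ?_
  rw [← Λ.comp_eq_self_of_mem_degLe hl hla hn, hcomp]
  exact Λ.comp_eq_self_of_mem_degLe hm hmb (hcomp ▸ hn)

end KGraph

/-- If `q` is a star projection dominated algebraically by a star projection `p`, then `q ≤ p`. -/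
theorem IsStarProjection.le_of_mul_eq {A : Type*} [Ring A] [StarRing A] [PartialOrder A]
    [StarOrderedRing A] {p q : A} (hp : IsStarProjection p) (hq : IsStarProjection q)
    (hpq : p * q = q) : q ≤ p := by
  have hqp : q * p = q := by
    simpa [hp.isSelfAdjoint.star_eq, hq.isSelfAdjoint.star_eq] using congrArg star hpq
  have hsub : star (p - q) * (p - q) = p - q := by
    rw [star_sub, hp.isSelfAdjoint.star_eq, hq.isSelfAdjoint.star_eq, sub_mul, mul_sub, mul_sub,
      hp.isIdempotentElem.eq, hq.isIdempotentElem.eq, hpq, hqp, sub_self, sub_zero]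
  rw [← sub_nonneg, ← hsub]
  exact star_mul_self_nonneg _

/-- The sum of the range projections of partial isometries with mutually orthogonal ranges is a
projection. -/
theorem isStarProjection_sum_mul_star {ι A : Type*} [Ring A] [StarRing A] (s : Finset ι)
    (t : ι → A) (ht : ∀ i ∈ s, t i * star (t i) * t i = t i)
    (horth : ∀ i ∈ s, ∀ j ∈ s, i ≠ j → star (t i) * t j = 0) :
    IsStarProjection (∑ i ∈ s, t i * star (t i)) where
  isIdempotentElem := by
    rw [IsIdempotentElem, Finset.sum_mul]
    refine Finset.sum_congr rfl fun i hi => ?_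
    rw [Finset.mul_sum, Finset.sum_eq_single_of_mem i hi, ← mul_assoc, ht i hi]
    intro j hj hji
    rw [mul_assoc, ← mul_assoc (star (t i)), horth i hi j hj hji.symm, zero_mul, mul_zero]
  isSelfAdjoint := isSelfAdjoint_sum s fun i _ => IsSelfAdjoint.mul_star_self (t i)

/-- for a finite `E ⊆ vΛ^{≤ n}`, `Σ_{l ∈ E} t_l t_l^* ≤ t_v`. -/
theorem stmt2 {k : ℕ} (Λ : KGraph k) (hΛ : Λ.FinitelyAligned)
    {A : Type*} [CStarAlgebra A] [PartialOrder A] [StarOrderedRing A]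
    (t : Λ.Path → A) (ht : Λ.IsCK13 t)
    (v : Λ.Path) (hv : Λ.IsVertex v) (n : Fin k → ℕ)
    (E : Set Λ.Path) (hEfin : E.Finite)
    (hEsub : E ⊆ Λ.degLe n ∩ Λ.withRange v) :
    setSum E (fun l => t l * star (t l)) ≤ t v := by
  have hmem : ∀ l ∈ hEfin.toFinset, l ∈ Λ.degLe n ∧ Λ.rng l = v := fun l hl =>
    hEsub (hEfin.mem_toFinset.mp hl)
  rw [setSum, dif_pos hEfin]
  obtain ⟨hstar, hidem⟩ := ht.vertex_projection v hv
  refine IsStarProjection.le_of_mul_eq ⟨hidem, hstar⟩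
    (isStarProjection_sum_mul_star _ t (fun l _ => ht.partialIsometry l) ?_) ?_
  · intro l hl m hm hlm
    rw [ht.ck3, Λ.minExt_eq_empty_of_mem_degLe (hmem l hl).1 (hmem m hm).1 hlm]
    simp [setSum]
  · rw [Finset.mul_sum]
    refine Finset.sum_congr rfl fun l hl => ?_
    have hvl : Λ.src v = Λ.rng l := by rw [Λ.src_eq_of_deg_zero v hv, (hmem l hl).2]
    have hcomp : Λ.comp v l = l := by rw [← (hmem l hl).2, Λ.rng_comp_self]
    rw [← mul_assoc, ht.comp_mul v l hvl, hcomp]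
end

section
/- Let (Λ,d) be a finitely aligned k-graph, E ⊆ Λ finite, and {t_λ : λ ∈ Λ} a Cuntz–Krieger Λ-family. Then {Q(t)^{ΠE}_λ : λ ∈ ΠE} is a family of mutually orthogonal projections, and for every vertex v ∈ r(ΠE) one has ∏_{λ ∈ vΠE} (t_v − t_λ t_λ*) + Σ_{μ ∈ vΠE} Q(t)^{ΠE}_μ = t_v. -/
open scoped BigOperators

section OrderedProducts

variable {ι A : Type*}

theorem setSum_eq_sum [AddCommMonoid A] {S : Set ι} (hS : S.Finite) (f : ι → A) :
    setSum S f = ∑ i ∈ hS.toFinset, f i := by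
  simp [setSum, hS]

theorem mul_setProd_eq_self [Monoid A] {S : Set ι} {f : ι → A} {a : A}
    (h : ∀ i ∈ S, a * f i = a) : a * setProd S f = a := by
  have key : ∀ L : List A, (∀ x ∈ L, a * x = a) → a * L.prod = a := by
    intro L
    induction L with
    | nil => simp
    | cons x L ih =>
      intro hL
      rw [List.prod_cons, ← mul_assoc, hL x (by simp), ih fun y hy => hL y (by simp [hy])]
  unfold setProd
  split_ifs with hS
  · refine key _ fun x hx => ?_
    obtain ⟨i, hi, rfl⟩ := List.mem_map.1 hx
    exact h i (by simpa using hi)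
  · simp

theorem mul_setProd_eq_zero [MonoidWithZero A] {S : Set ι} (hS : S.Finite) {f : ι → A} {a : A}
    {i : ι} (hi : i ∈ S) (hf : ∀ j ∈ S, Commute (f i) (f j)) (h : a * f i = 0) :
    a * setProd S f = 0 := by
  have key : ∀ (y : A) (L : List A) (b : A), y ∈ L → (∀ x ∈ L, Commute y x) → b * y = 0 →
      b * L.prod = 0 := by
    intro y L
    induction L with
    | nil => simp
    | cons x L ih =>
      intro b hy hc hb
      rw [List.prod_cons, ← mul_assoc]
      rcases List.mem_cons.1 hy with rfl | hy
      · rw [hb, zero_mul]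
      · refine ih _ hy (fun z hz => hc z (by simp [hz])) ?_
        rw [mul_assoc, ← (hc x (by simp)).eq, ← mul_assoc, hb, zero_mul]
  rw [setProd, dif_pos hS]
  refine key (f i) _ a (List.mem_map.2 ⟨i, by simpa using hi, rfl⟩) (fun x hx => ?_) h
  obtain ⟨j, hj, rfl⟩ := List.mem_map.1 hx
  exact hf j (by simpa using hj)

theorem commute_setProd [Monoid A] {S : Set ι} {f : ι → A} {a : A}
    (h : ∀ i ∈ S, Commute a (f i)) : Commute a (setProd S f) := by
  unfold setProd
  split_ifs with hS
  · refine Commute.list_prod_right _ _ fun x hx => ?_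
    obtain ⟨i, hi, rfl⟩ := List.mem_map.1 hx
    exact h i (by simpa using hi)
  · exact Commute.one_right a

theorem isStarProjection_setProd [Semiring A] [StarRing A] {S : Set ι} {f : ι → A}
    (hf : ∀ i ∈ S, IsStarProjection (f i)) (hc : ∀ i ∈ S, ∀ j ∈ S, Commute (f i) (f j)) :
    IsStarProjection (setProd S f) := by
  have key : ∀ L : List A, (∀ x ∈ L, IsStarProjection x) →
      (∀ x ∈ L, ∀ y ∈ L, Commute x y) → IsStarProjection L.prod := by
    intro L
    induction L with
    | nil => intro _ _; simp
    | cons x L ih =>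
      intro hL hc
      rw [List.prod_cons]
      exact (hL x (by simp)).mul (ih (fun y hy => hL y (by simp [hy]))
        fun y hy z hz => hc y (by simp [hy]) z (by simp [hz]))
        (Commute.list_prod_right _ _ fun y hy => hc x (by simp) y (by simp [hy]))
  unfold setProd
  split_ifs with hS
  · refine key _ (fun x hx => ?_) fun x hx y hy => ?_
    · obtain ⟨i, hi, rfl⟩ := List.mem_map.1 hx
      exact hf i (by simpa using hi)
    · obtain ⟨i, hi, rfl⟩ := List.mem_map.1 hx
      obtain ⟨j, hj, rfl⟩ := List.mem_map.1 hy
      exact hc i (by simpa using hi) j (by simpa using hj)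
  · simp

end OrderedProducts

namespace KGraph

section Combinatorics

variable {k : ℕ} {Λ : KGraph k}

theorem factorisation_unique {a b c d : Λ.Path} (hab : Λ.src a = Λ.rng b)
    (hcd : Λ.src c = Λ.rng d) (hdeg : Λ.deg a = Λ.deg c) (h : Λ.comp a b = Λ.comp c d) :
    a = c ∧ b = d := by
  have h1 := Λ.deg_comp a b hab
  have h2 := Λ.deg_comp c d hcd
  have hbd : Λ.deg d = Λ.deg b := by
    rw [← h, h1, hdeg] at h2
    exact (add_left_cancel h2).symm
  have := (Λ.factorisation _ _ _ h1).unique (y₁ := (a, b)) (y₂ := (c, d))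
    ⟨rfl, rfl, hab, rfl⟩ ⟨hdeg.symm, hbd, hcd, h.symm⟩
  exact Prod.mk.inj this

theorem comp_left_cancel {l a b : Λ.Path} (ha : Λ.src l = Λ.rng a) (hb : Λ.src l = Λ.rng b)
    (h : Λ.comp l a = Λ.comp l b) : a = b :=
  (factorisation_unique ha hb rfl h).2

theorem comp_eq_self_of_deg_eq {l a : Λ.Path} (ha : Λ.src l = Λ.rng a)
    (h : Λ.deg (Λ.comp l a) = Λ.deg l) : Λ.comp l a = l := by
  rw [Λ.deg_comp l a ha] at h
  have h0 : Λ.deg a = 0 := by simpa using h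
  rw [← Λ.rng_eq_of_deg_zero a h0, ← ha, Λ.comp_src_self]

theorem exists_comp_of_le_deg (l : Λ.Path) {m : Fin k → ℕ} (h : m ≤ Λ.deg l) :
    ∃ a b, Λ.deg a = m ∧ Λ.src a = Λ.rng b ∧ Λ.comp a b = l := by
  obtain ⟨⟨a, b⟩, ⟨ha, -, hab, hl⟩, -⟩ :=
    Λ.factorisation l m (Λ.deg l - m) (add_tsub_cancel_of_le h).symm
  exact ⟨a, b, ha, hab, hl⟩

theorem swap_mem_minExt {l m a b : Λ.Path} (h : (a, b) ∈ Λ.minExt l m) :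
    (b, a) ∈ Λ.minExt m l := by
  obtain ⟨h1, h2, h3, h4⟩ := h
  exact ⟨h2, h1, h3.symm, by simpa [h3, sup_comm] using h4⟩

/-- Any two factorisations of a path through `l` and `m` pass through a minimal common extension. -/
theorem exists_minExt_of_comp_eq {l m a b : Λ.Path} (ha : Λ.src l = Λ.rng a)
    (hb : Λ.src m = Λ.rng b) (h : Λ.comp l a = Λ.comp m b) :
    ∃ a' b' c, (a', b') ∈ Λ.minExt l m ∧ Λ.src a' = Λ.rng c ∧ Λ.src b' = Λ.rng c ∧
      a = Λ.comp a' c ∧ b = Λ.comp b' c := by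
  have hla := Λ.deg_comp l a ha
  have hmb := Λ.deg_comp m b hb
  have hle : Λ.deg l ⊔ Λ.deg m ≤ Λ.deg (Λ.comp l a) :=
    sup_le (by rw [hla]; exact le_self_add) (by rw [h, hmb]; exact le_self_add)
  obtain ⟨x, c, hx, hxc, hxl⟩ := exists_comp_of_le_deg _ hle
  have key : ∀ l a, Λ.src l = Λ.rng a → Λ.deg l ≤ Λ.deg x → Λ.comp x c = Λ.comp l a →
      ∃ a', Λ.src l = Λ.rng a' ∧ Λ.comp l a' = x ∧ Λ.src a' = Λ.rng c ∧ a = Λ.comp a' c := by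
    intro l a ha hl hxl
    obtain ⟨l', a', hd, hs, hx'⟩ := exists_comp_of_le_deg x hl
    have hsc : Λ.src a' = Λ.rng c := by rw [← hxc, ← hx', Λ.src_comp _ _ hs]
    rw [← hx', Λ.comp_assoc _ _ _ hs hsc] at hxl
    obtain ⟨rfl, rfl⟩ := factorisation_unique (by rw [hs, Λ.rng_comp _ _ hsc]) ha hd hxl
    exact ⟨a', hs, hx', hsc, rfl⟩
  obtain ⟨a', h1, h2, h3, h4⟩ := key l a ha (hx ▸ le_sup_left) hxl
  obtain ⟨b', h5, h6, h7, h8⟩ := key m b hb (hx ▸ le_sup_right) (hxl.trans h)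
  exact ⟨a', b', c, ⟨h1, h5, h2.trans h6.symm, by rw [h2, hx]⟩, h3, h7, h4, h8⟩

theorem subset_piSet (E : Set Λ.Path) : E ⊆ Λ.piSet E :=
  Set.subset_sInter fun _ hF => hF.1

theorem piSet_subset {E F : Set Λ.Path} (hE : E ⊆ F) (hF : Λ.DaggerClosed F) :
    Λ.piSet E ⊆ F :=
  Set.sInter_subset_of_mem ⟨hE, hF⟩

/-- By symmetry it suffices to check one half of condition (†). -/
theorem daggerClosed_of_left {F : Set Λ.Path}
    (h : ∀ l m σ a b, l ∈ F → m ∈ F → σ ∈ F → Λ.deg l = Λ.deg m → Λ.src l = Λ.src m →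
      (a, b) ∈ Λ.minExt m σ → Λ.comp l a ∈ F) : Λ.DaggerClosed F :=
  fun l m σ τ a b hl hm hσ hτ hd hd' hs hs' hab =>
    ⟨h l m σ a b hl hm hσ hd hs hab, h τ σ m b a hτ hσ hm hd'.symm hs'.symm (swap_mem_minExt hab)⟩

theorem daggerClosed_piSet (E : Set Λ.Path) : Λ.DaggerClosed (Λ.piSet E) := by
  refine daggerClosed_of_left fun l m σ a b hl hm hσ hd hs hab F hF => ?_
  exact (hF.2 l m σ σ a b (hl F hF) (hm F hF) (hσ F hF) (hσ F hF) hd rfl hs rfl hab).1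

theorem deg_comp_of_mem_minExt {l m σ a b : Λ.Path} (hd : Λ.deg l = Λ.deg m)
    (hs : Λ.src l = Λ.src m) (hab : (a, b) ∈ Λ.minExt m σ) :
    Λ.deg (Λ.comp l a) = Λ.deg m ⊔ Λ.deg σ := by
  rw [Λ.deg_comp l a (hs.trans hab.1), hd, ← Λ.deg_comp m a hab.1, hab.2.2.2]

theorem exists_deg_le_of_mem_piSet {E : Set Λ.Path} (hE : E.Finite) :
    ∃ N : Fin k → ℕ, ∀ l ∈ Λ.piSet E, Λ.deg l ≤ N := by
  obtain ⟨N, hN⟩ := (hE.image Λ.deg).bddAbove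
  refine ⟨N, piSet_subset (F := {l | Λ.deg l ≤ N})
    (fun l hl => hN (Set.mem_image_of_mem _ hl)) ?_⟩
  refine daggerClosed_of_left fun l m σ a b hl hm hσ hd hs hab => ?_
  rw [Set.mem_ofPred_eq, deg_comp_of_mem_minExt hd hs hab]
  exact sup_le hm hσ

/-- Paths `la` with `(a, b) ∈ Λ^min(m, σ)` for some `l, m, σ` in `S`. -/
def minExtPaths (S : Set Λ.Path) : Set Λ.Path :=
  ⋃ l ∈ S, ⋃ m ∈ S, ⋃ σ ∈ S, (fun p => Λ.comp l p.1) '' Λ.minExt m σ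

/-- Paths obtained from members of `G` by replacing an initial segment in `S` by another path
in `S` with the same degree and source. -/
def swapPaths (S G : Set Λ.Path) : Set Λ.Path :=
  ⋃ l ∈ S, ⋃ m ∈ S, ⋃ g ∈ G, Λ.comp l '' {a | Λ.deg l = Λ.deg m ∧ Λ.src l = Λ.src m ∧
    Λ.src m = Λ.rng a ∧ Λ.comp m a = g}

theorem finite_minExtPaths (hΛ : Λ.FinitelyAligned) {S : Set Λ.Path} (hS : S.Finite) :
    (minExtPaths S).Finite :=
  hS.biUnion fun _ _ => hS.biUnion fun m _ => hS.biUnion fun σ _ => (hΛ m σ).image _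

theorem finite_swapPaths {S G : Set Λ.Path} (hS : S.Finite) (hG : G.Finite) :
    (swapPaths S G).Finite := by
  refine hS.biUnion fun l _ => hS.biUnion fun m _ => hG.biUnion fun g _ =>
    (Set.Subsingleton.finite ?_).image _
  rintro a ⟨-, -, ha, rfl⟩ b ⟨-, -, hb, h⟩
  exact comp_left_cancel ha hb h.symm

theorem mem_minExtPaths {S : Set Λ.Path} {l m σ a b : Λ.Path} (hl : l ∈ S) (hm : m ∈ S)
    (hσ : σ ∈ S) (hab : (a, b) ∈ Λ.minExt m σ) : Λ.comp l a ∈ minExtPaths S := by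
  simp only [minExtPaths, Set.mem_iUnion]
  exact ⟨l, hl, m, hm, σ, hσ, (a, b), hab, rfl⟩

theorem mem_swapPaths {S G : Set Λ.Path} {x : Λ.Path} :
    x ∈ swapPaths S G ↔ ∃ l ∈ S, ∃ m ∈ S, ∃ a, Λ.deg l = Λ.deg m ∧ Λ.src l = Λ.src m ∧
      Λ.src m = Λ.rng a ∧ Λ.comp m a ∈ G ∧ Λ.comp l a = x := by
  simp only [swapPaths, Set.mem_iUnion, Set.mem_image, Set.mem_ofPred_eq]
  constructor
  · rintro ⟨l, hl, m, hm, g, hg, a, ⟨hd, hs, ha, rfl⟩, rfl⟩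
    exact ⟨l, hl, m, hm, a, hd, hs, ha, hg, rfl⟩
  · rintro ⟨l, hl, m, hm, a, hd, hs, ha, hg, rfl⟩
    exact ⟨l, hl, m, hm, _, hg, a, ⟨hd, hs, ha, rfl⟩, rfl⟩

/-- A path of degree `n` in `ΠE` arises from `E` and the paths of smaller degree in `ΠE` by
taking one minimal common extension and replacing one initial segment. -/
theorem piSet_deg_eq_subset (E : Set Λ.Path) (n : Fin k → ℕ) :
    {l ∈ Λ.piSet E | Λ.deg l = n} ⊆
      (E ∪ minExtPaths {l ∈ Λ.piSet E | Λ.deg l < n}) ∪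
        swapPaths {l ∈ Λ.piSet E | Λ.deg l < n}
          (E ∪ minExtPaths {l ∈ Λ.piSet E | Λ.deg l < n}) := by
  set S := {l ∈ Λ.piSet E | Λ.deg l < n} with hS
  set G := E ∪ minExtPaths S with hG
  have hP := daggerClosed_piSet E
  suffices h : Λ.piSet E ⊆ {l ∈ Λ.piSet E | Λ.deg l = n → l ∈ G ∪ swapPaths S G} from
    fun l hl => (h hl.1).2 hl.2
  refine piSet_subset (fun l hl => ⟨subset_piSet E hl, fun _ => Or.inl (Or.inl hl)⟩) ?_
  refine daggerClosed_of_left fun l m σ a b hl hm hσ hd hs hab => ?_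
  refine ⟨(hP l m σ σ a b hl.1 hm.1 hσ.1 hσ.1 hd rfl hs rfl hab).1, fun hn => ?_⟩
  have hn' := deg_comp_of_mem_minExt hd hs hab
  rw [hn] at hn'
  rcases eq_or_lt_of_le (hn' ▸ le_sup_left : Λ.deg m ≤ n) with hmn | hmn
  · have hln := hd.trans hmn
    rw [comp_eq_self_of_deg_eq (hs.trans hab.1) (hn.trans hln.symm)]
    exact hl.2 hln
  have hlS : l ∈ S := ⟨hl.1, hd ▸ hmn⟩
  have hmS : m ∈ S := ⟨hm.1, hmn⟩
  rcases eq_or_lt_of_le (hn' ▸ le_sup_right : Λ.deg σ ≤ n) with hσn | hσn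
  swap
  · exact Or.inl (Or.inr (mem_minExtPaths hlS hmS ⟨hσ.1, hσn⟩ hab))
  have hma : Λ.comp m a = σ := by
    rw [hab.2.2.1]
    exact comp_eq_self_of_deg_eq hab.2.1 (by rw [← hab.2.2.1, hab.2.2.2, ← hn', hσn])
  rcases hσ.2 hσn with hσG | hσH
  · exact Or.inr (mem_swapPaths.2 ⟨l, hlS, m, hmS, a, hd, hs, hab.1, hma ▸ hσG, rfl⟩)
  obtain ⟨l₁, hl₁, m₁, hm₁, a₁, hd₁, hs₁, ha₁, hG₁, hσ₁⟩ := mem_swapPaths.1 hσH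
  obtain ⟨a', b', c, hmin, hac, hbc, rfl, rfl⟩ :=
    exists_minExt_of_comp_eq hab.1 (hs₁.trans ha₁) (hma.trans hσ₁.symm)
  have hsl := hs.trans hmin.1
  have hsm := hs₁.symm.trans hmin.2.1
  have hdeg := deg_comp_of_mem_minExt hd hs hmin
  have hdeg₁ := deg_comp_of_mem_minExt hd₁.symm hs₁.symm (swap_mem_minExt hmin)
  obtain ⟨hla, hmb⟩ :=
    hP l m l₁ m₁ a' b' hl.1 hm.1 hl₁.1 hm₁.1 hd hd₁ hs hs₁ hmin
  rw [← Λ.comp_assoc _ _ _ hsl hac] at hn ⊢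
  rcases eq_or_lt_of_le (sup_le hmn.le hl₁.2.le) with heq | hlt
  · left; right
    rw [comp_eq_self_of_deg_eq (by rw [Λ.src_comp _ _ hsl, hac]) (by rw [hn, hdeg, heq])]
    exact mem_minExtPaths hlS hmS hl₁ hmin
  · right
    refine mem_swapPaths.2 ⟨_, ⟨hla, hdeg ▸ hlt⟩, _, ⟨hmb, ?_⟩, c, ?_, ?_, ?_, ?_, rfl⟩
    · rw [hdeg₁, sup_comm]; exact hlt
    · rw [hdeg, hdeg₁, sup_comm]
    · rw [Λ.src_comp _ _ hsl, Λ.src_comp _ _ hsm, hac, hbc]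
    · rw [Λ.src_comp _ _ hsm, hbc]
    · rwa [Λ.comp_assoc _ _ _ hsm hbc]

theorem finite_piSet (hΛ : Λ.FinitelyAligned) {E : Set Λ.Path} (hE : E.Finite) :
    (Λ.piSet E).Finite := by
  have hdeg : ∀ n : Fin k → ℕ, {l ∈ Λ.piSet E | Λ.deg l = n}.Finite := by
    intro n
    induction n using WellFoundedLT.induction with
    | ind n ih =>
      have hS : {l ∈ Λ.piSet E | Λ.deg l < n}.Finite :=
        ((Set.finite_Iio n).biUnion ih).subset fun l hl =>
          Set.mem_biUnion (Set.mem_Iio.2 hl.2) ⟨hl.1, rfl⟩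
      have hG := hE.union (finite_minExtPaths hΛ hS)
      exact (hG.union (finite_swapPaths hS hG)).subset (piSet_deg_eq_subset E n)
  obtain ⟨N, hN⟩ := exists_deg_le_of_mem_piSet hE
  exact ((Set.finite_Iic N).biUnion fun n _ => hdeg n).subset fun l hl =>
    Set.mem_biUnion (Set.mem_Iic.2 (hN l hl)) ⟨hl, rfl⟩

theorem finite_extInto {P : Set Λ.Path} (hP : P.Finite) (l : Λ.Path) :
    (Λ.extInto P l).Finite :=
  Set.Finite.of_finite_image (f := Λ.comp l)
    (hP.subset (by rintro _ ⟨ν, hν, rfl⟩; exact hν.2.2))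
    fun _ ha _ hb h => comp_left_cancel ha.1 hb.1 h

end Combinatorics

section Algebra

variable {k : ℕ} {Λ : KGraph k} {A : Type*} [Ring A] [StarRing A] {t : Λ.Path → A}

namespace IsCK13

theorem isStarProjection_mul_star (ht : Λ.IsCK13 t) (l : Λ.Path) :
    IsStarProjection (t l * star (t l)) :=
  ⟨by rw [IsIdempotentElem, ← mul_assoc, ht.partialIsometry], IsSelfAdjoint.mul_star_self _⟩

theorem mul_star_mul_comp (ht : Λ.IsCK13 t) {l a : Λ.Path} (ha : Λ.src l = Λ.rng a) :
    t l * star (t l) * (t (Λ.comp l a) * star (t (Λ.comp l a))) =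
      t (Λ.comp l a) * star (t (Λ.comp l a)) := by
  rw [← mul_assoc, ← ht.comp_mul l a ha, ← mul_assoc, ht.partialIsometry]

theorem comp_mul_mul_star (ht : Λ.IsCK13 t) {l a : Λ.Path} (ha : Λ.src l = Λ.rng a) :
    t (Λ.comp l a) * star (t (Λ.comp l a)) * (t l * star (t l)) =
      t (Λ.comp l a) * star (t (Λ.comp l a)) := by
  simpa using congrArg star (ht.mul_star_mul_comp ha)

theorem mul_star_mul_mul_star (ht : Λ.IsCK13 t) (hΛ : Λ.FinitelyAligned) (l m : Λ.Path) :
    t l * star (t l) * (t m * star (t m)) = ∑ p ∈ (hΛ l m).toFinset,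
      t (Λ.comp l p.1) * star (t (Λ.comp l p.1)) := by
  have h : t l * star (t l) * (t m * star (t m)) = t l * (star (t l) * t m) * star (t m) := by
    noncomm_ring
  rw [h, ht.ck3, setSum_eq_sum (hΛ l m), Finset.mul_sum, Finset.sum_mul]
  refine Finset.sum_congr rfl fun p hp => ?_
  obtain ⟨h1, h2, h3, -⟩ := (hΛ l m).mem_toFinset.1 hp
  conv_rhs => rw [h3, ← ht.comp_mul m p.2 h2, star_mul, ← mul_assoc, ht.comp_mul m p.2 h2, ← h3,
    ← ht.comp_mul l p.1 h1]
  simp only [mul_assoc]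

theorem commute_mul_star (ht : Λ.IsCK13 t) (hΛ : Λ.FinitelyAligned) (l m : Λ.Path) :
    Commute (t l * star (t l)) (t m * star (t m)) := by
  have h := congrArg star (ht.mul_star_mul_mul_star hΛ l m)
  simp only [star_sum, star_mul, star_star] at h
  exact (ht.mul_star_mul_mul_star hΛ l m).trans h.symm

theorem isStarProjection_vertex (ht : Λ.IsCK13 t) {v : Λ.Path} (hv : Λ.IsVertex v) :
    IsStarProjection (t v) :=
  ⟨(ht.vertex_projection v hv).2, (ht.vertex_projection v hv).1⟩

theorem vertex_mul_mul_star (ht : Λ.IsCK13 t) (l : Λ.Path) :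
    t (Λ.rng l) * (t l * star (t l)) = t l * star (t l) := by
  rw [← mul_assoc, ht.comp_mul _ _ (Λ.src_eq_of_deg_zero _ (Λ.deg_rng l)), Λ.rng_comp_self]

theorem mul_star_mul_vertex (ht : Λ.IsCK13 t) (l : Λ.Path) :
    t l * star (t l) * t (Λ.rng l) = t l * star (t l) := by
  simpa [(ht.vertex_projection _ (Λ.deg_rng l)).1] using
    congrArg star (ht.vertex_mul_mul_star l)

theorem isStarProjection_Qproj (ht : Λ.IsCK13 t) (hΛ : Λ.FinitelyAligned) (E : Set Λ.Path)
    (l : Λ.Path) : IsStarProjection (Λ.Qproj t E l) := by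
  have hc := ht.commute_mul_star hΛ
  refine (ht.isStarProjection_mul_star l).mul (isStarProjection_setProd (fun ν hν => ?_)
    fun ν _ ξ _ => ?_) (commute_setProd fun ν _ => (hc _ _).sub_right (hc _ _))
  · exact (ht.isStarProjection_mul_star _).sub_of_mul_eq_left (ht.isStarProjection_mul_star l)
      (ht.comp_mul_mul_star hν.1)
  · exact ((hc _ _).sub_right (hc _ _)).sub_left ((hc _ _).sub_right (hc _ _))

theorem mul_star_mul_Qproj (ht : Λ.IsCK13 t) (E : Set Λ.Path) (l : Λ.Path) :
    t l * star (t l) * Λ.Qproj t E l = Λ.Qproj t E l := by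
  rw [Qproj, ← mul_assoc, (ht.isStarProjection_mul_star l).isIdempotentElem.eq]

theorem Qproj_mul_mul_star (ht : Λ.IsCK13 t) (hΛ : Λ.FinitelyAligned) (E : Set Λ.Path)
    (l : Λ.Path) : Λ.Qproj t E l * (t l * star (t l)) = Λ.Qproj t E l := by
  simpa [(ht.isStarProjection_Qproj hΛ E l).isSelfAdjoint.star_eq] using
    congrArg star (ht.mul_star_mul_Qproj E l)

theorem comp_mul_Qproj_eq_zero (ht : Λ.IsCK13 t) (hΛ : Λ.FinitelyAligned) {E : Set Λ.Path}
    (hE : E.Finite) {l ν : Λ.Path} (hν : ν ∈ Λ.extInto (Λ.piSet E) l) :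
    t (Λ.comp l ν) * star (t (Λ.comp l ν)) * Λ.Qproj t E l = 0 := by
  have hc := ht.commute_mul_star hΛ
  rw [Qproj, ← mul_assoc, ht.comp_mul_mul_star hν.1]
  refine mul_setProd_eq_zero (finite_extInto (finite_piSet hΛ hE) l) hν
    (fun ξ _ => ((hc _ _).sub_right (hc _ _)).sub_left ((hc _ _).sub_right (hc _ _))) ?_
  rw [mul_sub, ht.comp_mul_mul_star hν.1,
    (ht.isStarProjection_mul_star _).isIdempotentElem.eq, sub_self]

theorem Qproj_mul_comp_eq_zero (ht : Λ.IsCK13 t) (hΛ : Λ.FinitelyAligned) {E : Set Λ.Path}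
    (hE : E.Finite) {l ν : Λ.Path} (hν : ν ∈ Λ.extInto (Λ.piSet E) l) :
    Λ.Qproj t E l * (t (Λ.comp l ν) * star (t (Λ.comp l ν))) = 0 := by
  simpa [(ht.isStarProjection_Qproj hΛ E l).isSelfAdjoint.star_eq] using
    congrArg star (ht.comp_mul_Qproj_eq_zero hΛ hE hν)

theorem Qproj_mul_Qproj_of_ne (ht : Λ.IsCK13 t) (hΛ : Λ.FinitelyAligned) {E : Set Λ.Path}
    (hE : E.Finite) {l m : Λ.Path} (hl : l ∈ Λ.piSet E) (hm : m ∈ Λ.piSet E) (hlm : l ≠ m) :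
    Λ.Qproj t E l * Λ.Qproj t E m = 0 := by
  have h : Λ.Qproj t E l * Λ.Qproj t E m =
      Λ.Qproj t E l * (t l * star (t l) * (t m * star (t m))) * Λ.Qproj t E m := by
    rw [← mul_assoc, ht.Qproj_mul_mul_star hΛ, mul_assoc _ _ (Λ.Qproj t E m),
      ht.mul_star_mul_Qproj]
  rw [h, ht.mul_star_mul_mul_star hΛ, Finset.mul_sum, Finset.sum_mul]
  refine Finset.sum_eq_zero fun p hp => ?_
  obtain ⟨a, b⟩ := p
  have hp := (hΛ l m).mem_toFinset.1 hp
  obtain ⟨h1, h2, h3, -⟩ := id hp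
  obtain ⟨hla, hmb⟩ :=
    daggerClosed_piSet E l l m m a b hl hl hm hm rfl rfl rfl rfl hp
  dsimp only at h1 h2 h3 ⊢
  by_cases ha : Λ.deg a = 0
  · by_cases hb : Λ.deg b = 0
    · refine absurd ?_ hlm
      rwa [comp_eq_self_of_deg_eq h1 (by rw [Λ.deg_comp _ _ h1, ha, add_zero]),
        comp_eq_self_of_deg_eq h2 (by rw [Λ.deg_comp _ _ h2, hb, add_zero])] at h3
    · rw [h3, mul_assoc, ht.comp_mul_Qproj_eq_zero hΛ hE ⟨h2, hb, hmb⟩, mul_zero]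
  · rw [ht.Qproj_mul_comp_eq_zero hΛ hE ⟨h1, ha, hla⟩, zero_mul]

theorem setProd_add_setSum_Qproj (ht : Λ.IsCK13 t) (hΛ : Λ.FinitelyAligned) {E : Set Λ.Path}
    (hE : E.Finite) {v : Λ.Path} (hv : (Λ.piSet E ∩ Λ.withRange v).Nonempty) :
    setProd (Λ.piSet E ∩ Λ.withRange v) (fun l => t v - t l * star (t l)) +
      setSum (Λ.piSet E ∩ Λ.withRange v) (fun m => Λ.Qproj t E m) = t v := by
  set S := Λ.piSet E ∩ Λ.withRange v with hSdef
  have hS : S.Finite := (finite_piSet hΛ hE).inter_of_left _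
  obtain ⟨l₀, hl₀⟩ := hv
  have hvv : Λ.IsVertex v := by
    rw [← show Λ.rng l₀ = v from hl₀.2]
    exact Λ.deg_rng l₀
  have htv := ht.isStarProjection_vertex hvv
  have hvp : ∀ l ∈ S, t v * (t l * star (t l)) = t l * star (t l) := fun l hl => by
    simpa [show Λ.rng l = v from hl.2] using ht.vertex_mul_mul_star l
  have hpv : ∀ l ∈ S, t l * star (t l) * t v = t l * star (t l) := fun l hl => by
    simpa [show Λ.rng l = v from hl.2] using ht.mul_star_mul_vertex l
  have hvQ : ∀ l ∈ S, t v * Λ.Qproj t E l = Λ.Qproj t E l := fun l hl => by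
    rw [Qproj, ← mul_assoc, hvp l hl]
  have hQv : ∀ l ∈ S, Λ.Qproj t E l * t v = Λ.Qproj t E l := fun l hl => by
    rw [← ht.Qproj_mul_mul_star hΛ, mul_assoc, hpv l hl]
  set q := setSum S (fun m => Λ.Qproj t E m) with hq
  rw [setSum_eq_sum hS] at hq
  have hqv : q * t v = q := by
    rw [hq, Finset.sum_mul]
    exact Finset.sum_congr rfl fun l hl => hQv l (hS.mem_toFinset.1 hl)
  have hqQ : ∀ l ∈ S, q * Λ.Qproj t E l = Λ.Qproj t E l := fun l hl => by
    rw [hq, Finset.sum_mul, Finset.sum_eq_single l]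
    · exact (ht.isStarProjection_Qproj hΛ E l).isIdempotentElem
    · exact fun m hm hml => ht.Qproj_mul_Qproj_of_ne hΛ hE (hS.mem_toFinset.1 hm).1 hl.1 hml
    · exact fun h => absurd (hS.mem_toFinset.2 hl) h
  -- The complement of `q` in `t v` annihilates each range projection: check longest paths first.
  have hB : ∀ l ∈ S, (t v - q) * (t l * star (t l)) = 0 := by
    by_contra! hbad
    obtain ⟨l, ⟨hl, hne⟩, hmax⟩ := Set.Finite.exists_maximalFor Λ.deg
      {l ∈ S | (t v - q) * (t l * star (t l)) ≠ 0} (hS.subset (Set.sep_subset _ _)) hbad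
    refine hne ?_
    have hext : ∀ ν ∈ Λ.extInto (Λ.piSet E) l,
        (t v - q) * (t (Λ.comp l ν) * star (t (Λ.comp l ν))) = 0 := by
      intro ν hν
      by_contra hcon
      have hd := Λ.deg_comp l ν hν.1
      have := hmax ⟨⟨hν.2.2, (Λ.rng_comp l ν hν.1).trans hl.2⟩, hcon⟩ (hd ▸ le_self_add)
      rw [hd] at this
      exact hν.2.1 (by simpa using this)
    have h : (t v - q) * (t l * star (t l)) = (t v - q) * Λ.Qproj t E l := by
      rw [Qproj, ← mul_assoc _ (t l * star (t l))]
      refine (mul_setProd_eq_self fun ν hν => ?_).symm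
      rw [mul_assoc, mul_sub, (ht.isStarProjection_mul_star l).isIdempotentElem.eq,
        ht.mul_star_mul_comp hν.1, mul_sub, hext ν hν, sub_zero]
    rw [h, sub_mul, hvQ l hl, hqQ l hl, sub_self]
  have hvc : ∀ l ∈ S, Commute (t v) (t l * star (t l)) :=
    fun l hl => (hvp l hl).trans (hpv l hl).symm
  have hcomm : ∀ l ∈ S, ∀ m ∈ S, Commute (t v - t l * star (t l)) (t v - t m * star (t m)) :=
    fun l hl m hm => ((Commute.refl _).sub_right (hvc m hm)).sub_left
      ((hvc l hl).symm.sub_right (ht.commute_mul_star hΛ l m))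
  set R := setProd S (fun l => t v - t l * star (t l))
  have hvR : t v * R = R := by
    have : (1 - t v) * R = 0 := mul_setProd_eq_zero hS hl₀ (hcomm l₀ hl₀) (by
      rw [sub_mul, one_mul, mul_sub, htv.isIdempotentElem.eq, hvp l₀ hl₀, sub_self])
    rw [sub_mul, one_mul, sub_eq_zero] at this
    exact this.symm
  have hBR : (t v - q) * R = t v - q := mul_setProd_eq_self fun l hl => by
    rw [mul_sub, hB l hl, sub_mul, htv.isIdempotentElem.eq, hqv, sub_zero]
  have hqR : q * R = 0 := by
    rw [hq, Finset.sum_mul]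
    refine Finset.sum_eq_zero fun l hl => ?_
    have hl := hS.mem_toFinset.1 hl
    exact mul_setProd_eq_zero hS hl (hcomm l hl) (by
      rw [mul_sub, hQv l hl, ht.Qproj_mul_mul_star hΛ, sub_self])
  rw [sub_mul, hqR, hvR, sub_zero] at hBR
  rw [hBR, sub_add_cancel]

end IsCK13

end Algebra

end KGraph

/-- the `Q(t)^{ΠE}_l` are mutually orthogonal projections, and for each
`v ∈ r(ΠE)`, `∏_{l ∈ vΠE}(t_v - t_l t_l^*) + Σ_{m ∈ vΠE} Q(t)^{ΠE}_m = t_v`. -/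
theorem stmt7 {k : ℕ} (Λ : KGraph k) (hΛ : Λ.FinitelyAligned)
    (E : Set Λ.Path) (hE : E.Finite) {A : Type*} [CStarAlgebra A]
    (t : Λ.Path → A) (ht : Λ.IsCKFamily t) :
    (∀ l ∈ Λ.piSet E,
      Λ.Qproj t E l * Λ.Qproj t E l = Λ.Qproj t E l ∧
        star (Λ.Qproj t E l) = Λ.Qproj t E l) ∧
    (∀ l ∈ Λ.piSet E, ∀ m ∈ Λ.piSet E, l ≠ m →
      Λ.Qproj t E l * Λ.Qproj t E m = 0) ∧
    (∀ v : Λ.Path, (∃ l ∈ Λ.piSet E, Λ.rng l = v) →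
      setProd (Λ.piSet E ∩ Λ.withRange v) (fun l => t v - t l * star (t l)) +
        setSum (Λ.piSet E ∩ Λ.withRange v) (fun m => Λ.Qproj t E m) = t v) := by
  have ht := ht.toIsCK13
  refine ⟨fun l _ => ?_, fun l hl m hm hlm => ht.Qproj_mul_Qproj_of_ne hΛ hE hl hm hlm,
    fun v ⟨l, hl, hlv⟩ => ht.setProd_add_setSum_Qproj hΛ hE ⟨l, hl, hlv⟩⟩
  have h := ht.isStarProjection_Qproj hΛ E l
  exact ⟨h.isIdempotentElem, h.isSelfAdjoint⟩
end
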